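/- Let d ≥ 1, let h₁, h₂ > 0, and let M ⊆ ℝ^d be a nonempty finite min-max closed set with |M| = m. Let f̂(u) = (1/m)·Σ_{x ∈ M} N_{h₁}(u − x) be the totally positive kernel density estimator. Then the convolution of f̂ with the scaled standard Gaussian N_{h₂}, namely the function C(a) = ∫_{ℝ^d} f̂(a − y) · N_{h₂}(y) dy, is MTP₂, i.e. C(u)·C(v) ≤ C(u ∧ v)·C(u ∨ v) for all u, v ∈ ℝ^d. -/

import Mathlib

open MeasureTheory

/-- The scaled standard Gaussian kernel on ℝ^d with covariance h²·I. -/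
noncomputable def gaussKernel (d : ℕ) (h : ℝ) (z : Fin d → ℝ) : ℝ :=
  (2 * Real.pi * h ^ 2) ^ (-(d : ℝ) / 2) * Real.exp (-(∑ i, (z i) ^ 2) / (2 * h ^ 2))

lemma integrable_exp_neg_mul_sum_sq (d : ℕ) {b : ℝ} (hb : 0 < b) :
    Integrable (fun y : Fin d → ℝ => Real.exp (-b * ∑ i, y i ^ 2)) := by
  have h := Integrable.fintype_prod (ι := Fin d) (μ := fun _ => (volume : Measure ℝ))
    (f := fun _ t => Real.exp (-b * t ^ 2)) (fun _ => integrable_exp_neg_mul_sq hb)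
  simpa only [← Real.exp_sum, ← Finset.mul_sum, ← volume_pi] using h

/-- Completing the square in a product of two Gaussian kernels. -/
lemma gaussKernel_sub_mul_gaussKernel {d : ℕ} {h₁ h₂ : ℝ} (hh₁ : 0 < h₁) (hh₂ : 0 < h₂)
    (w y : Fin d → ℝ) :
    gaussKernel d h₁ (w - y) * gaussKernel d h₂ y =
      (2 * Real.pi * h₁ ^ 2) ^ (-(d : ℝ) / 2) * (2 * Real.pi * h₂ ^ 2) ^ (-(d : ℝ) / 2) *
        Real.exp (-(∑ i, w i ^ 2) / (2 * (h₁ ^ 2 + h₂ ^ 2))) *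
        Real.exp (-((h₁ ^ 2 + h₂ ^ 2) / (2 * h₁ ^ 2 * h₂ ^ 2)) *
          ∑ i, (y - (h₂ ^ 2 / (h₁ ^ 2 + h₂ ^ 2)) • w) i ^ 2) := by
  have hexp : Real.exp (-(∑ i, (w - y) i ^ 2) / (2 * h₁ ^ 2)) *
      Real.exp (-(∑ i, y i ^ 2) / (2 * h₂ ^ 2)) =
      Real.exp (-(∑ i, w i ^ 2) / (2 * (h₁ ^ 2 + h₂ ^ 2))) *
        Real.exp (-((h₁ ^ 2 + h₂ ^ 2) / (2 * h₁ ^ 2 * h₂ ^ 2)) *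
          ∑ i, (y - (h₂ ^ 2 / (h₁ ^ 2 + h₂ ^ 2)) • w) i ^ 2) := by
    rw [← Real.exp_add, ← Real.exp_add]
    congr 1
    simp only [← Finset.sum_neg_distrib, Finset.sum_div, Finset.mul_sum,
      ← Finset.sum_add_distrib]
    refine Finset.sum_congr rfl fun i _ => ?_
    have hH : h₁ ^ 2 + h₂ ^ 2 ≠ 0 := by positivity
    simp only [Pi.sub_apply, Pi.smul_apply, smul_eq_mul]
    field_simp
    ring
  unfold gaussKernel
  linear_combination (2 * Real.pi * h₁ ^ 2) ^ (-(d : ℝ) / 2) *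
    (2 * Real.pi * h₂ ^ 2) ^ (-(d : ℝ) / 2) * hexp

lemma integrable_gaussKernel_sub_mul {d : ℕ} {h₁ h₂ : ℝ} (hh₁ : 0 < h₁) (hh₂ : 0 < h₂)
    (w : Fin d → ℝ) :
    Integrable (fun y => gaussKernel d h₁ (w - y) * gaussKernel d h₂ y) := by
  simp only [gaussKernel_sub_mul_gaussKernel hh₁ hh₂]
  exact ((integrable_exp_neg_mul_sum_sq d (by positivity)).comp_sub_right _).const_mul _

/-- Up to a constant factor, the convolution of two Gaussian kernels is a Gaussian. -/
lemma exists_integral_gaussKernel_sub_mul {d : ℕ} {h₁ h₂ : ℝ} (hh₁ : 0 < h₁) (hh₂ : 0 < h₂) :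
    ∃ K : ℝ, ∀ w : Fin d → ℝ,
      ∫ y, gaussKernel d h₁ (w - y) * gaussKernel d h₂ y =
        K * Real.exp (-(∑ i, w i ^ 2) / (2 * (h₁ ^ 2 + h₂ ^ 2))) := by
  refine ⟨(2 * Real.pi * h₁ ^ 2) ^ (-(d : ℝ) / 2) * (2 * Real.pi * h₂ ^ 2) ^ (-(d : ℝ) / 2) *
    ∫ y : Fin d → ℝ, Real.exp (-((h₁ ^ 2 + h₂ ^ 2) / (2 * h₁ ^ 2 * h₂ ^ 2)) * ∑ i, y i ^ 2),
    fun w => ?_⟩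
  simp only [gaussKernel_sub_mul_gaussKernel hh₁ hh₂]
  rw [integral_const_mul, integral_sub_right_eq_self (fun y : Fin d → ℝ =>
    Real.exp (-((h₁ ^ 2 + h₂ ^ 2) / (2 * h₁ ^ 2 * h₂ ^ 2)) * ∑ i, y i ^ 2))]
  ring

lemma sq_inf_sub_inf_add_sq_sup_sub_sup_le (u v x y : ℝ) :
    (u ⊓ v - x ⊓ y) ^ 2 + (u ⊔ v - x ⊔ y) ^ 2 ≤ (u - x) ^ 2 + (v - y) ^ 2 := by
  rcases le_total u v with h | h <;> rcases le_total x y with h' | h' <;> simp only [h, h',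
    inf_of_le_left, inf_of_le_right, sup_of_le_left, sup_of_le_right] <;>
    nlinarith [mul_nonneg (sub_nonneg.2 h) (sub_nonneg.2 h')]

lemma exp_sum_sq_sub_mul_le {d : ℕ} {c : ℝ} (hc : 0 ≤ c) (u v x y : Fin d → ℝ) :
    Real.exp (-(∑ i, (u - x) i ^ 2) / c) * Real.exp (-(∑ i, (v - y) i ^ 2) / c) ≤
      Real.exp (-(∑ i, (u ⊓ v - x ⊓ y) i ^ 2) / c) *
        Real.exp (-(∑ i, (u ⊔ v - x ⊔ y) i ^ 2) / c) := by
  rw [← Real.exp_add, ← Real.exp_add, Real.exp_le_exp, ← add_div, ← add_div]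
  refine div_le_div_of_nonneg_right ?_ hc
  rw [← neg_add, ← neg_add, neg_le_neg_iff, ← Finset.sum_add_distrib, ← Finset.sum_add_distrib]
  exact Finset.sum_le_sum fun i _ => sq_inf_sub_inf_add_sq_sup_sub_sup_le _ _ _ _

/-- A sum of equal-width isotropic Gaussians centred on a finite min-max closed set is MTP₂. -/
lemma sum_exp_sum_sq_sub_mul_le {d : ℕ} {c : ℝ} (hc : 0 ≤ c) (M : Finset (Fin d → ℝ))
    (hM : ∀ a ∈ M, ∀ b ∈ M, a ⊓ b ∈ M ∧ a ⊔ b ∈ M) (u v : Fin d → ℝ) :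
    (∑ x ∈ M, Real.exp (-(∑ i, (u - x) i ^ 2) / c)) *
        (∑ x ∈ M, Real.exp (-(∑ i, (v - x) i ^ 2) / c)) ≤
      (∑ x ∈ M, Real.exp (-(∑ i, (u ⊓ v - x) i ^ 2) / c)) *
        (∑ x ∈ M, Real.exp (-(∑ i, (u ⊔ v - x) i ^ 2) / c)) := by
  classical
  have hexp : ∀ w : Fin d → ℝ, 0 ≤ fun x : Fin d → ℝ => Real.exp (-(∑ i, (w - x) i ^ 2) / c) :=
    fun _ _ => (Real.exp_pos _).le
  refine (four_functions_theorem _ _ _ _ (hexp u) (hexp v) (hexp (u ⊓ v)) (hexp (u ⊔ v))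
    (exp_sum_sq_sub_mul_le hc u v) M M).trans (mul_le_mul ?_ ?_ ?_ ?_)
  · exact Finset.sum_le_sum_of_subset_of_nonneg
      (Finset.infs_subset_iff.2 fun a ha b hb => (hM a ha b hb).1) fun _ _ _ => hexp _ _
  · exact Finset.sum_le_sum_of_subset_of_nonneg
      (Finset.sups_subset_iff.2 fun a ha b hb => (hM a ha b hb).2) fun _ _ _ => hexp _ _
  · exact Finset.sum_nonneg fun _ _ => hexp _ _
  · exact Finset.sum_nonneg fun _ _ => hexp _ _

theorem tpkde_conv_gaussian_is_MTP2 (d : ℕ) (hd : 1 ≤ d)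
    (h₁ h₂ : ℝ) (hh₁ : 0 < h₁) (hh₂ : 0 < h₂)
    (M : Finset (Fin d → ℝ)) (hMne : M.Nonempty)
    (hMclosed : ∀ a ∈ M, ∀ b ∈ M, a ⊓ b ∈ M ∧ a ⊔ b ∈ M)
    (fhat : (Fin d → ℝ) → ℝ)
    (hfhat : ∀ u, fhat u = (1 / (M.card : ℝ)) * ∑ x ∈ M, gaussKernel d h₁ (u - x))
    (C : (Fin d → ℝ) → ℝ)
    (hC : ∀ a, C a = ∫ y, fhat (a - y) * gaussKernel d h₂ y) :
    ∀ u v : Fin d → ℝ, C u * C v ≤ C (u ⊓ v) * C (u ⊔ v) := by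
  obtain ⟨K, hint⟩ := exists_integral_gaussKernel_sub_mul (d := d) hh₁ hh₂
  have hCK : ∀ a, C a = 1 / (M.card : ℝ) * K *
      ∑ x ∈ M, Real.exp (-(∑ i, (a - x) i ^ 2) / (2 * (h₁ ^ 2 + h₂ ^ 2))) := by
    intro a
    have hfg : ∀ y, fhat (a - y) * gaussKernel d h₂ y =
        1 / (M.card : ℝ) * ∑ x ∈ M, gaussKernel d h₁ (a - x - y) * gaussKernel d h₂ y := by
      intro y
      rw [hfhat, mul_assoc, Finset.sum_mul]
      simp_rw [sub_sub, add_comm y]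
    simp only [hC, hfg]
    rw [integral_const_mul,
      integral_finsetSum _ fun x _ => integrable_gaussKernel_sub_mul hh₁ hh₂ (a - x)]
    simp only [hint, ← Finset.mul_sum, mul_assoc]
  intro u v
  simp only [hCK]
  have hsum := sum_exp_sum_sq_sub_mul_le (c := 2 * (h₁ ^ 2 + h₂ ^ 2)) (by positivity) M hMclosed u v
  linear_combination (1 / (M.card : ℝ) * K) ^ 2 * hsum
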